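/- Let m, k be positive integers with every prime factor of m greater than k^k, and let S' be a subset of size k of Z_m. Then there exists an automorphism α₁ of Z_m such that α₁(S') ⊆ {−⌊m/k⌋, −⌊m/k⌋+1, …, ⌊m/k⌋}, where the elements of this set are interpreted as residues modulo m. -/

import Mathlib

theorem Nat.coprime_of_forall_prime_dvd_lt {m d : ℕ} (hd : 0 < d)
    (h : ∀ p : ℕ, p.Prime → p ∣ m → d < p) : d.Coprime m :=
  Nat.coprime_of_dvd fun p hp hpd hpm =>
    absurd (Nat.le_of_dvd hd hpd) (not_le.2 (h p hp hpm))

theorem abs_sub_le_div_of_mul_div_eq {m k x y : ℕ} (hm : 0 < m) (hk : 0 < k)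
    (h : k * x / m = k * y / m) : |(y : ℤ) - x| ≤ (m / k : ℕ) := by
  have hx := Nat.div_add_mod (k * x) m
  have hy := Nat.div_add_mod (k * y) m
  have hx' := Nat.mod_lt (k * x) hm
  have hy' := Nat.mod_lt (k * y) hm
  have hx0 := Nat.zero_le (k * x % m)
  have hy0 := Nat.zero_le (k * y % m)
  rw [h] at hx
  have hk' : (0 : ℤ) < k := by exact_mod_cast hk
  push_cast
  rw [Int.le_ediv_iff_mul_le hk', ← abs_of_pos hk', ← abs_mul, abs_le]
  zify at hx hy hx' hy' hx0 hy0
  constructor <;> linarith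

/-- Let `S'` be a subset of size `k` of `ℤ_m`, where every prime factor of `m`
exceeds `k^k`. Then there is an automorphism `α₁` of `ℤ_m` mapping `S'` into
`{-⌊m/k⌋, …, ⌊m/k⌋}` (residues modulo `m`). -/
theorem zmod_automorphism_rectification (m k : ℕ) (hm : 0 < m) (hk : 0 < k)
    (hprime : ∀ p : ℕ, p.Prime → p ∣ m → k ^ k < p)
    (S' : Finset (ZMod m)) (hcard : S'.card = k) :
    ∃ α₁ : ZMod m ≃+ ZMod m,
      ∀ x ∈ S', ∃ j : ℤ, |j| ≤ (m / k : ℕ) ∧ α₁ x = (j : ZMod m) := by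
  have : NeZero m := ⟨hm.ne'⟩
  let f : Fin (k ^ k + 1) → (S' → Fin k) := fun a s =>
    ⟨k * ((a : ℕ) * (s : ZMod m)).val / m,
      Nat.div_lt_of_lt_mul (by
        rw [mul_comm m k]
        exact Nat.mul_lt_mul_of_pos_left (ZMod.val_lt _) hk)⟩
  obtain ⟨a, b, hab, hf⟩ : ∃ a b : Fin (k ^ k + 1), a < b ∧ f a = f b := by
    obtain ⟨a, b, hne, hf⟩ := Fintype.exists_ne_map_eq_of_card_lt f (by simp [hcard])
    rcases lt_or_gt_of_ne hne with h | h
    · exact ⟨a, b, h, hf⟩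
    · exact ⟨b, a, h, hf.symm⟩
  have hab' : (a : ℕ) < b := hab
  have hcop : ((b : ℕ) - a).Coprime m :=
    Nat.coprime_of_forall_prime_dvd_lt (by omega) fun p hp hpm =>
      lt_of_le_of_lt (by omega) (hprime p hp hpm)
  refine ⟨AddAut.mulLeft (ZMod.unitOfCoprime _ hcop), fun x hx =>
    ⟨(((b : ℕ) * x : ZMod m).val : ℤ) - ((a : ℕ) * x : ZMod m).val, ?_, ?_⟩⟩
  · exact abs_sub_le_div_of_mul_div_eq hm hk (congrArg Fin.val (congrFun hf ⟨x, hx⟩))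
  · simp [Units.smul_def, Nat.cast_sub hab'.le, sub_mul]
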